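/- arXiv:1111.6017 — 6 statements merged into one kernel-verified Lean document; each statement's English description precedes it below -/
import Mathlib

section
/- Let Φ be a simple point process on ℝ^d whose mean measure α(B) = E[Φ(B)] is finite on all bounded Borel sets, and whose second factorial moment measure α^(2), defined on Borel A ⊆ ℝ^d × ℝ^d by α^(2)(A) = E[(Φ_ω × Φ_ω)(A ∖ Δ)] with Δ = {(x,x) : x ∈ ℝ^d} the diagonal and Φ_ω × Φ_ω the product measure, is finite on all bounded Borel subsets of ℝ^d × ℝ^d. Suppose that for any two disjoint bounded Borel sets B1, B2 ⊆ ℝ^d, P(Φ(B1) = 0 and Φ(B2) = 0) ≤ P(Φ(B1) = 0) · P(Φ(B2) = 0). Then Φ is ν-weakly sub-Poisson: for every bounded Borel set B ⊆ ℝ^d, P(Φ(B) = 0) ≤ exp(−α(B)). -/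
open MeasureTheory ProbabilityTheory Bornology

open scoped ENNReal Topology
open Filter

/-- The cell of level `n` and address `c` of the dyadic partition induced by the digits of `f`. -/
def digitCell {E : Type*} (f : E → ℕ → Bool) (n : ℕ) (c : Fin n → Bool) : Set E :=
  (fun x (i : Fin n) => f x i) ⁻¹' {c}

section digitCell

variable {E : Type*} {f : E → ℕ → Bool}

lemma disjoint_digitCell {n : ℕ} {c c' : Fin n → Bool} (h : c ≠ c') :
    Disjoint (digitCell f n c) (digitCell f n c') :=
  (Set.disjoint_singleton.2 h).preimage _

lemma iUnion_digitCell (n : ℕ) : ⋃ c, digitCell f n c = Set.univ := by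
  ext x
  simp [digitCell]

lemma iInter_digitCell (hf : Function.Injective f) (x : E) :
    ⋂ n, digitCell f n (fun i => f x i) = {x} := by
  ext y
  simp only [digitCell, Set.mem_iInter, Set.mem_preimage, Set.mem_singleton_iff]
  refine ⟨fun h => hf (funext fun k => ?_), fun h n => by rw [h]⟩
  exact congrFun (h (k + 1)) ⟨k, k.lt_succ_self⟩

lemma antitone_digitCell (x : E) : Antitone fun n => digitCell f n (fun i => f x i) := by
  intro m n hmn y hy
  simp only [digitCell, Set.mem_preimage, Set.mem_singleton_iff] at hy ⊢
  exact funext fun i => congrFun hy (Fin.castLE hmn i)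

variable [MeasurableSpace E]

lemma measurable_digits (hf : Measurable f) (n : ℕ) : Measurable fun x (i : Fin n) => f x i :=
  measurable_pi_lambda _ fun i => (measurable_pi_apply (i : ℕ)).comp hf

lemma measurableSet_digitCell (hf : Measurable f) (n : ℕ) (c : Fin n → Bool) :
    MeasurableSet (digitCell f n c) :=
  measurable_digits hf n (MeasurableSet.singleton c)

/-- A finite measure whose atoms have mass at most one has total mass at most the asymptotic number
of charged cells. -/
lemma measure_univ_le_liminf_card_charged (hf : Measurable f) (hinj : Function.Injective f)
    (ν : Measure E) [IsFiniteMeasure ν] (hν : ∀ x, ν {x} ≤ 1) :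
    ν Set.univ ≤
      liminf (fun n => ∑ c, if ν (digitCell f n c) = 0 then 0 else (1 : ℝ≥0∞)) atTop := by
  have hlim (x : E) : Tendsto (fun n => (ν (digitCell f n fun i => f x i))⁻¹) atTop
      (𝓝 (ν {x})⁻¹) := by
    rw [← iInter_digitCell hinj x]
    exact (tendsto_measure_iInter_atTop
      (fun n => (measurableSet_digitCell hf n _).nullMeasurableSet) (antitone_digitCell x)
      ⟨0, measure_ne_top _ _⟩).inv
  have hmeas (n : ℕ) : Measurable fun x => (ν (digitCell f n fun i => f x i))⁻¹ :=
    (measurable_of_finite fun c : Fin n → Bool => (ν (digitCell f n c))⁻¹).comp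
      (measurable_digits hf n)
  calc ν Set.univ = ∫⁻ _, 1 ∂ν := by simp
    _ ≤ ∫⁻ x, liminf (fun n => (ν (digitCell f n fun i => f x i))⁻¹) atTop ∂ν :=
        lintegral_mono fun x => by
          rw [(hlim x).liminf_eq]
          exact ENNReal.one_le_inv.2 (hν x)
    _ ≤ liminf (fun n => ∫⁻ x, (ν (digitCell f n fun i => f x i))⁻¹ ∂ν) atTop :=
        lintegral_liminf_le hmeas
    _ ≤ _ := by
        refine liminf_le_liminf (Eventually.of_forall fun n => ?_)
        have hmap : ∫⁻ x, (ν (digitCell f n fun i => f x i))⁻¹ ∂ν =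
            ∫⁻ c, (ν (digitCell f n c))⁻¹ ∂(ν.map fun x (i : Fin n) => f x i) :=
          (lintegral_map (f := fun c : Fin n → Bool => (ν (digitCell f n c))⁻¹)
            (measurable_of_finite _) (measurable_digits hf n)).symm
        rw [hmap, lintegral_fintype]
        refine Finset.sum_le_sum fun c _ => ?_
        rw [Measure.map_apply (measurable_digits hf n) (MeasurableSet.singleton c)]
        change (ν (digitCell f n c))⁻¹ * ν (digitCell f n c) ≤ _
        split_ifs with h
        · simp [h]
        · exact ENNReal.inv_mul_le_one _

end digitCell

/-- Negative correlation of the void events of two disjoint bounded sets extends to finite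
families. -/
lemma measure_void_biUnion_le_prod {E Ω ι : Type*} [MeasurableSpace E] [Bornology E]
    [MeasurableSpace Ω] (P : Measure Ω) [IsProbabilityMeasure P] (Φ : Ω → Measure E)
    (hvoid : ∀ B₁ B₂ : Set E, MeasurableSet B₁ → MeasurableSet B₂ → IsBounded B₁ → IsBounded B₂ →
      Disjoint B₁ B₂ →
      P {ω | Φ ω B₁ = 0 ∧ Φ ω B₂ = 0} ≤ P {ω | Φ ω B₁ = 0} * P {ω | Φ ω B₂ = 0})
    (C : ι → Set E) (hC : ∀ i, MeasurableSet (C i)) (hb : ∀ i, IsBounded (C i))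
    (hd : Pairwise (Function.onFun Disjoint C)) (S : Finset ι) :
    P {ω | Φ ω (⋃ i ∈ S, C i) = 0} ≤ ∏ i ∈ S, P {ω | Φ ω (C i) = 0} := by
  classical
  induction S using Finset.induction_on with
  | empty => simp
  | insert a S ha ih =>
    rw [Finset.prod_insert ha]
    simp only [Finset.set_biUnion_insert, measure_union_null_iff]
    refine (hvoid _ _ (hC a) (S.measurableSet_biUnion fun i _ => hC i) (hb a)
      ((isBounded_biUnion_finset S).2 fun i _ => hb i) ?_).trans (by gcongr)
    refine Set.disjoint_iUnion₂_right.2 fun i hi => hd ?_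
    rintro rfl
    exact ha hi

/-- A simple point process with Radon mean measure and Radon second factorial moment measure,
whose void probabilities over disjoint bounded Borel sets are negatively correlated, is
ν-weakly sub-Poisson: `P(Φ(B) = 0) ≤ exp(−α(B))` for every bounded Borel set `B`. -/
theorem nu_weakly_subPoisson_of_void_subadditive
    {d : ℕ} {Ω : Type*} [MeasurableSpace Ω] (P : Measure Ω) [IsProbabilityMeasure P]
    (Φ : Ω → Measure (EuclideanSpace ℝ (Fin d)))
    (hmeas : ∀ B : Set (EuclideanSpace ℝ (Fin d)), MeasurableSet B →
      Measurable fun ω => Φ ω B)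
    (hlocfin : ∀ᵐ ω ∂P, ∀ B : Set (EuclideanSpace ℝ (Fin d)), IsBounded B → Φ ω B < ⊤)
    (hsimple : ∀ᵐ ω ∂P, ∀ x : EuclideanSpace ℝ (Fin d), Φ ω {x} ≤ 1)
    (hα : ∀ B : Set (EuclideanSpace ℝ (Fin d)), MeasurableSet B → IsBounded B →
      ∫⁻ ω, Φ ω B ∂P < ⊤)
    (hα2 : ∀ A : Set (EuclideanSpace ℝ (Fin d) × EuclideanSpace ℝ (Fin d)),
      MeasurableSet A → IsBounded A →
      ∫⁻ ω, ((Φ ω).prod (Φ ω)) (A \ {p | p.1 = p.2}) ∂P < ⊤)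
    (hvoid : ∀ B₁ B₂ : Set (EuclideanSpace ℝ (Fin d)),
      MeasurableSet B₁ → MeasurableSet B₂ → IsBounded B₁ → IsBounded B₂ →
      Disjoint B₁ B₂ →
      P {ω | Φ ω B₁ = 0 ∧ Φ ω B₂ = 0} ≤ P {ω | Φ ω B₁ = 0} * P {ω | Φ ω B₂ = 0}) :
    ∀ B : Set (EuclideanSpace ℝ (Fin d)), MeasurableSet B → IsBounded B →
      (P {ω | Φ ω B = 0}).toReal ≤ Real.exp (-(∫⁻ ω, Φ ω B ∂P).toReal) := by
  intro B hB hBb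
  obtain ⟨f, hf, hinj⟩ := MeasurableSpace.measurable_injection_nat_bool_of_countablySeparated
    (EuclideanSpace ℝ (Fin d))
  have hcell (n : ℕ) (c : Fin n → Bool) : MeasurableSet (B ∩ digitCell f n c) :=
    hB.inter (measurableSet_digitCell hf n c)
  have hnull (n : ℕ) (c : Fin n → Bool) : MeasurableSet {ω | Φ ω (B ∩ digitCell f n c) = 0} :=
    hmeas _ (hcell n c) (MeasurableSet.singleton 0)
  have hmean : ∫⁻ ω, Φ ω B ∂P ≤
      liminf (fun n => ∑ c, P {ω | Φ ω (B ∩ digitCell f n c) = 0}ᶜ) atTop := by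
    calc ∫⁻ ω, Φ ω B ∂P
        ≤ ∫⁻ ω, liminf (fun n => ∑ c,
            {ω | Φ ω (B ∩ digitCell f n c) = 0}ᶜ.indicator (1 : Ω → ℝ≥0∞) ω) atTop ∂P := by
          refine lintegral_mono_ae ?_
          filter_upwards [hlocfin, hsimple] with ω hfin hone
          have : IsFiniteMeasure ((Φ ω).restrict B) := ⟨by simpa using hfin B hBb⟩
          have key := measure_univ_le_liminf_card_charged hf hinj ((Φ ω).restrict B)
            fun x => (Measure.restrict_apply_le _ _).trans (hone x)
          simpa [Measure.restrict_apply, measurableSet_digitCell hf, Set.indicator_apply,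
            Set.inter_comm, ite_not] using key
      _ ≤ liminf (fun n => ∫⁻ ω, ∑ c,
            {ω | Φ ω (B ∩ digitCell f n c) = 0}ᶜ.indicator (1 : Ω → ℝ≥0∞) ω ∂P) atTop :=
          lintegral_liminf_le fun n => Finset.measurable_sum _ fun c _ =>
            measurable_one.indicator (hnull n c).compl
      _ = _ := by
          refine congrArg (liminf · atTop) (funext fun n => ?_)
          rw [lintegral_finsetSum _ fun c _ => measurable_one.indicator (hnull n c).compl]
          exact Finset.sum_congr rfl fun c _ => lintegral_indicator_one (hnull n c).compl
  have hvoid_le (n : ℕ) : (P {ω | Φ ω B = 0}).toReal ≤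
      Real.exp (-(∑ c, P {ω | Φ ω (B ∩ digitCell f n c) = 0}ᶜ).toReal) := by
    have h := measure_void_biUnion_le_prod P Φ hvoid (fun c => B ∩ digitCell f n c) (hcell n)
      (fun c => hBb.subset Set.inter_subset_left)
      (fun c c' hc => (disjoint_digitCell hc).mono Set.inter_subset_right Set.inter_subset_right)
      Finset.univ
    simp only [Finset.mem_univ, Set.iUnion_true, ← Set.inter_iUnion, iUnion_digitCell,
      Set.inter_univ] at h
    refine (ENNReal.toReal_mono (ENNReal.prod_ne_top fun c _ => measure_ne_top _ _) h).trans ?_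
    rw [ENNReal.toReal_prod, ENNReal.toReal_sum fun c _ => measure_ne_top _ _,
      ← Finset.sum_neg_distrib, Real.exp_sum]
    refine Finset.prod_le_prod (fun c _ => ENNReal.toReal_nonneg) fun c _ => ?_
    have hc := probReal_compl_eq_one_sub (μ := P) (hnull n c)
    have hexp := Real.one_sub_le_exp_neg (P.real {ω | Φ ω (B ∩ digitCell f n c) = 0}ᶜ)
    simp only [Measure.real] at hc hexp
    linarith
  rcases (ENNReal.toReal_nonneg (a := P {ω | Φ ω B = 0})).eq_or_lt with h0 | hpos
  · rw [← h0]
    positivity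
  have hbound : ∫⁻ ω, Φ ω B ∂P ≤ ENNReal.ofReal (-Real.log (P {ω | Φ ω B = 0}).toReal) := by
    refine hmean.trans (liminf_le_of_le (by isBoundedDefault) fun b hb => ?_)
    obtain ⟨n, hn⟩ := hb.exists
    refine hn.trans ((ENNReal.le_ofReal_iff_toReal_le
      (ENNReal.sum_ne_top.2 fun c _ => measure_ne_top _ _) ?_).2 ?_)
    · exact neg_nonneg.2 (Real.log_nonpos hpos.le measureReal_le_one)
    · linarith [(Real.log_le_iff_le_exp hpos).2 (hvoid_le n)]
  have hreal := ENNReal.toReal_le_of_le_ofReal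
    (neg_nonneg.2 (Real.log_nonpos hpos.le measureReal_le_one)) hbound
  rw [← Real.log_le_iff_le_exp hpos]
  linarith
end

section
/- Let Φ be a simple point process on ℝ^d whose mean measure α(B) = E[Φ(B)] is finite on all bounded Borel sets, and suppose Φ is negatively associated: for any bounded Borel sets B1,…,Bl ⊆ ℝ^d with (B1 ∪ ⋯ ∪ Bk) ∩ (B_{k+1} ∪ ⋯ ∪ Bl) = ∅ and any coordinatewise nondecreasing measurable functions f : ℝ^k → ℝ and g : ℝ^{l−k} → ℝ for which the relevant expectations are finite, Cov(f(Φ(B1),…,Φ(Bk)), g(Φ(B_{k+1}),…,Φ(Bl))) ≤ 0. Then Φ is weakly sub-Poisson: (i) for all pairwise disjoint bounded Borel sets B1,…,Bk, E[∏_{i=1}^k Φ(Bi)] ≤ ∏_{i=1}^k E[Φ(Bi)], and (ii) for every bounded Borel set B, P(Φ(B) = 0) ≤ exp(−E[Φ(B)]). -/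
open MeasureTheory ProbabilityTheory Bornology

section Counting

open Filter Topology MeasurableSpace
open scoped ENNReal

variable {E : Type*} [MeasurableSpace E] [CountablyGenerated E]

lemma antitone_countablePartitionSet (x : E) :
    Antitone fun n => countablePartitionSet n x := by
  classical
  refine antitone_nat_of_succ_le fun n => ?_
  simp only [countablePartitionSet]
  rw [memPartitionSet_succ]
  split_ifs
  · exact Set.inter_subset_left
  · exact Set.sdiff_subset

lemma iInter_countablePartitionSet [MeasurableSingletonClass E] (x : E) :
    ⋂ n, countablePartitionSet n x = {x} := by
  refine Set.Subset.antisymm (fun y hy => ?_)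
    (Set.singleton_subset_iff.2 (Set.mem_iInter.2 fun n => mem_countablePartitionSet n x))
  rw [Set.mem_iInter] at hy
  have hsep := separating_of_generateFrom (⋃ n, countablePartition E n)
    (h := by rw [generateFrom_iUnion_countablePartition]; infer_instance)
  refine (hsep x y fun s hs => ?_).symm
  obtain ⟨n, hn⟩ := Set.mem_iUnion.1 hs
  have hyx : countablePartitionSet n y = countablePartitionSet n x :=
    countablePartitionSet_of_mem (countablePartitionSet_mem n x) (hy n)
  rw [← countablePartitionSet_eq_iff x hn, ← countablePartitionSet_eq_iff y hn, hyx]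

lemma biUnion_countablePartition_toFinset (n : ℕ) :
    ⋃ s ∈ (finite_countablePartition E n).toFinset, s = Set.univ := by
  simpa [Set.sUnion_eq_biUnion] using sUnion_countablePartition E n

/-- A finite measure whose atoms have mass at most one has total mass at most the asymptotic
number of non-null cells in the canonical sequence of finite partitions. -/
lemma measure_univ_le_liminf_card_nonnull [MeasurableSingletonClass E]
    (μ : Measure E) [IsFiniteMeasure μ] (hμ : ∀ x, μ {x} ≤ 1) :
    μ Set.univ ≤ liminf (fun n => ∑ s ∈ (finite_countablePartition E n).toFinset,
      ({0}ᶜ : Set ℝ≥0∞).indicator 1 (μ s)) atTop := by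
  set F : ℕ → E → ℝ≥0∞ := fun n x => ∑ s ∈ (finite_countablePartition E n).toFinset,
    s.indicator (fun _ => (μ s)⁻¹) x with hF
  have hmeas : ∀ n, ∀ s ∈ (finite_countablePartition E n).toFinset, MeasurableSet s :=
    fun n s hs => measurableSet_countablePartition n (by simpa using hs)
  have hFmeas : ∀ n, Measurable (F n) := fun n =>
    Finset.measurable_fun_sum _ fun s hs => measurable_const.indicator (hmeas n s hs)
  have hFval : ∀ n x, F n x = (μ (countablePartitionSet n x))⁻¹ := by
    intro n x
    rw [hF]
    dsimp only
    rw [Finset.sum_eq_single (countablePartitionSet n x)]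
    · exact Set.indicator_of_mem (mem_countablePartitionSet n x) _
    · intro s hs hne
      refine Set.indicator_of_notMem (fun hx => hne ?_) _
      exact (countablePartitionSet_of_mem (by simpa using hs) hx).symm
    · intro h
      exact absurd (by simpa using countablePartitionSet_mem n x) h
  have hFint : ∀ n, ∫⁻ x, F n x ∂μ ≤ ∑ s ∈ (finite_countablePartition E n).toFinset,
      ({0}ᶜ : Set ℝ≥0∞).indicator 1 (μ s) := by
    intro n
    rw [lintegral_finsetSum _ fun s hs => measurable_const.indicator (hmeas n s hs)]
    refine Finset.sum_le_sum fun s hs => ?_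
    rw [lintegral_indicator_const (hmeas n s hs)]
    by_cases h0 : μ s = 0
    · simp [h0]
    · simp [h0, ENNReal.inv_mul_cancel h0 (measure_ne_top μ s)]
  have hone : ∀ x, 1 ≤ liminf (fun n => F n x) atTop := by
    intro x
    have hlim : Tendsto (fun n => μ (countablePartitionSet n x)) atTop (𝓝 (μ {x})) := by
      rw [← iInter_countablePartitionSet x]
      exact tendsto_measure_iInter_atTop
        (fun n => (measurableSet_countablePartitionSet n x).nullMeasurableSet)
        (antitone_countablePartitionSet x) ⟨0, measure_ne_top _ _⟩
    have hinv := (tendsto_inv_iff.2 hlim).liminf_eq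
    simp only [hFval]
    rw [hinv]
    exact ENNReal.one_le_inv.2 (hμ x)
  calc μ Set.univ = ∫⁻ _, 1 ∂μ := by simp
    _ ≤ ∫⁻ x, liminf (fun n => F n x) atTop ∂μ := lintegral_mono hone
    _ ≤ liminf (fun n => ∫⁻ x, F n x ∂μ) atTop := lintegral_liminf_le hFmeas
    _ ≤ _ := liminf_le_liminf (Eventually.of_forall hFint)

end Counting

section NegativeAssociation

open Filter Topology MeasurableSpace
open scoped ENNReal

lemma measurableSet_void {E Ω : Type*} [MeasurableSpace E] [MeasurableSpace Ω]
    {Φ : Ω → Measure E}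
    (hmeas : ∀ B : Set E, MeasurableSet B → Measurable fun ω => Φ ω B)
    {B : Set E} (hB : MeasurableSet B) : MeasurableSet {ω | Φ ω B = 0} :=
  hmeas B hB (measurableSet_singleton 0)

variable {E : Type*} [MeasurableSpace E] [Bornology E] {Ω : Type*} [MeasurableSpace Ω]

/-- Negative association of a random measure: nondecreasing functions of the masses of two
families of bounded sets which are disjoint across the families are nonpositively correlated. -/
def NegativelyAssociated (P : Measure Ω) (Φ : Ω → Measure E) : Prop :=
  ∀ (k l : ℕ) (B : Fin k → Set E) (C : Fin l → Set E),
    (∀ i, MeasurableSet (B i)) → (∀ i, IsBounded (B i)) →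
    (∀ j, MeasurableSet (C j)) → (∀ j, IsBounded (C j)) →
    (∀ i j, Disjoint (B i) (C j)) →
    ∀ (f : (Fin k → ℝ) → ℝ) (g : (Fin l → ℝ) → ℝ),
      Measurable f → Measurable g → Monotone f → Monotone g →
      Integrable (fun ω => f (fun i => (Φ ω (B i)).toReal)) P →
      Integrable (fun ω => g (fun j => (Φ ω (C j)).toReal)) P →
      Integrable (fun ω =>
        f (fun i => (Φ ω (B i)).toReal) * g (fun j => (Φ ω (C j)).toReal)) P →
      ∫ ω, f (fun i => (Φ ω (B i)).toReal) * g (fun j => (Φ ω (C j)).toReal) ∂P ≤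
        (∫ ω, f (fun i => (Φ ω (B i)).toReal) ∂P) *
          (∫ ω, g (fun j => (Φ ω (C j)).toReal) ∂P)

variable {P : Measure Ω} [IsProbabilityMeasure P] {Φ : Ω → Measure E}

/-- For bounded test functions the integrability requirements of negative association hold. -/
lemma NegativelyAssociated.integral_mul_le (hNA : NegativelyAssociated P Φ)
    (hmeas : ∀ B : Set E, MeasurableSet B → Measurable fun ω => Φ ω B)
    {k l : ℕ} {B : Fin k → Set E} {C : Fin l → Set E}
    (hB : ∀ i, MeasurableSet (B i)) (hB' : ∀ i, IsBounded (B i))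
    (hC : ∀ j, MeasurableSet (C j)) (hC' : ∀ j, IsBounded (C j))
    (hBC : ∀ i j, Disjoint (B i) (C j))
    {f : (Fin k → ℝ) → ℝ} {g : (Fin l → ℝ) → ℝ}
    (hf : Measurable f) (hg : Measurable g) (hf' : Monotone f) (hg' : Monotone g)
    {a b : ℝ} (hfa : ∀ x, |f x| ≤ a) (hgb : ∀ x, |g x| ≤ b) :
    ∫ ω, f (fun i => (Φ ω (B i)).toReal) * g (fun j => (Φ ω (C j)).toReal) ∂P ≤
      (∫ ω, f (fun i => (Φ ω (B i)).toReal) ∂P) *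
        (∫ ω, g (fun j => (Φ ω (C j)).toReal) ∂P) := by
  have hfm : Measurable fun ω => f (fun i => (Φ ω (B i)).toReal) :=
    hf.comp (measurable_pi_lambda _ fun i => (hmeas _ (hB i)).ennreal_toReal)
  have hgm : Measurable fun ω => g (fun j => (Φ ω (C j)).toReal) :=
    hg.comp (measurable_pi_lambda _ fun i => (hmeas _ (hC i)).ennreal_toReal)
  have hfi : Integrable (fun ω => f (fun i => (Φ ω (B i)).toReal)) P :=
    .of_bound hfm.aestronglyMeasurable a (.of_forall fun ω => hfa _)
  have hgi : Integrable (fun ω => g (fun j => (Φ ω (C j)).toReal)) P :=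
    .of_bound hgm.aestronglyMeasurable b (.of_forall fun ω => hgb _)
  exact hNA k l B C hB hB' hC hC' hBC f g hf hg hf' hg' hfi hgi
    (hgi.bdd_mul hfm.aestronglyMeasurable (.of_forall fun ω => hfa _))

lemma NegativelyAssociated.integral_prod_le (hNA : NegativelyAssociated P Φ)
    (hmeas : ∀ B : Set E, MeasurableSet B → Measurable fun ω => Φ ω B)
    {h : ℝ → ℝ} (hh : Measurable h) (hmono : Monotone h) (hnonneg : ∀ x, 0 ≤ h x)
    {a : ℝ} (ha : ∀ x, h x ≤ a) {k : ℕ} {B : Fin k → Set E}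
    (hB : ∀ i, MeasurableSet (B i)) (hB' : ∀ i, IsBounded (B i))
    (hdisj : Pairwise (Function.onFun Disjoint B)) :
    ∫ ω, ∏ i, h (Φ ω (B i)).toReal ∂P ≤ ∏ i, ∫ ω, h (Φ ω (B i)).toReal ∂P := by
  induction k with
  | zero => simp
  | succ k ih =>
    have key := hNA.integral_mul_le (k := 1) (l := k) hmeas (B := fun _ => B 0)
      (C := fun j => B j.succ) (fun _ => hB 0) (fun _ => hB' 0) (fun j => hB j.succ)
      (fun j => hB' j.succ) (fun _ j => hdisj (Fin.succ_ne_zero j).symm)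
      (f := fun x => h (x 0)) (g := fun x => ∏ j, h (x j))
      (hh.comp (measurable_pi_apply 0))
      (Finset.measurable_fun_prod _ fun j _ => hh.comp (measurable_pi_apply j))
      (fun x y hxy => hmono (hxy 0))
      (fun x y hxy => Finset.prod_le_prod (fun j _ => hnonneg _) fun j _ => hmono (hxy j))
      (a := a) (b := a ^ k)
      (fun x => by rw [abs_of_nonneg (hnonneg _)]; exact ha _)
      (fun x => by
        rw [abs_of_nonneg (Finset.prod_nonneg fun j _ => hnonneg _)]
        simpa using Finset.prod_le_prod (s := Finset.univ) (fun j _ => hnonneg (x j))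
          fun j _ => ha (x j))
    simp only [Fin.prod_univ_succ]
    refine key.trans (mul_le_mul_of_nonneg_left ?_ (integral_nonneg fun ω => hnonneg _))
    exact ih (fun j => hB j.succ) (fun j => hB' j.succ)
      fun i j hij => hdisj fun h => hij (Fin.succ_injective _ h)

theorem NegativelyAssociated.lintegral_prod_le (hNA : NegativelyAssociated P Φ)
    (hmeas : ∀ B : Set E, MeasurableSet B → Measurable fun ω => Φ ω B)
    (hlocfin : ∀ᵐ ω ∂P, ∀ B : Set E, IsBounded B → Φ ω B < ⊤)
    {k : ℕ} {B : Fin k → Set E}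
    (hB : ∀ i, MeasurableSet (B i)) (hB' : ∀ i, IsBounded (B i))
    (hdisj : Pairwise (Function.onFun Disjoint B)) :
    ∫⁻ ω, ∏ i, Φ ω (B i) ∂P ≤ ∏ i, ∫⁻ ω, Φ ω (B i) ∂P := by
  set T : ℕ → ℝ → ℝ := fun m x => min (max x 0) m with hT
  have hTm : ∀ m, Measurable (T m) := fun m => by fun_prop
  have hTmono : ∀ m, Monotone (T m) := fun m x y hxy =>
    min_le_min_right _ (max_le_max_right _ hxy)
  have hT0 : ∀ m x, 0 ≤ T m x := fun m x => le_min (le_max_right _ _) m.cast_nonneg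
  have hTle : ∀ m x, T m x ≤ m := fun m x => min_le_right _ _
  have hTΦ : ∀ m i, Measurable fun ω => T m (Φ ω (B i)).toReal := fun m i =>
    (hTm m).comp (hmeas _ (hB i)).ennreal_toReal
  have hbound : ∀ m, ∫⁻ ω, ENNReal.ofReal (∏ i, T m (Φ ω (B i)).toReal) ∂P ≤
      ∏ i, ∫⁻ ω, Φ ω (B i) ∂P := by
    intro m
    have hint : Integrable (fun ω => ∏ i, T m (Φ ω (B i)).toReal) P := by
      refine .of_bound
        (Finset.measurable_fun_prod _ fun i _ => hTΦ m i).aestronglyMeasurable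
        ((m : ℝ) ^ k) (.of_forall fun ω => ?_)
      rw [Real.norm_of_nonneg (Finset.prod_nonneg fun j _ => hT0 _ _)]
      simpa using Finset.prod_le_prod (s := Finset.univ)
        (fun i _ => hT0 m (Φ ω (B i)).toReal) fun i _ => hTle m _
    rw [← ofReal_integral_eq_lintegral_ofReal hint
      (.of_forall fun ω => Finset.prod_nonneg fun j _ => hT0 _ _)]
    refine (ENNReal.ofReal_le_ofReal (hNA.integral_prod_le hmeas (hTm m) (hTmono m) (hT0 m)
      (hTle m) hB hB' hdisj)).trans ?_
    rw [ENNReal.ofReal_prod_of_nonneg fun i _ => integral_nonneg fun ω => hT0 _ _]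
    refine Finset.prod_le_prod' fun i _ => ?_
    have hi : Integrable (fun ω => T m (Φ ω (B i)).toReal) P :=
      .of_bound (hTΦ m i).aestronglyMeasurable m (.of_forall fun ω => by
        rw [Real.norm_of_nonneg (hT0 _ _)]
        exact hTle m _)
    rw [ofReal_integral_eq_lintegral_ofReal hi (.of_forall fun ω => hT0 _ _)]
    refine lintegral_mono fun ω => ?_
    refine (ENNReal.ofReal_le_ofReal (min_le_left _ _)).trans ?_
    rw [max_eq_left ENNReal.toReal_nonneg]
    exact ENNReal.ofReal_toReal_le
  calc ∫⁻ ω, ∏ i, Φ ω (B i) ∂P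
      ≤ ∫⁻ ω, liminf (fun m => ENNReal.ofReal (∏ i, T m (Φ ω (B i)).toReal)) atTop ∂P := by
        refine lintegral_mono_ae ?_
        filter_upwards [hlocfin] with ω hω
        have hev : ∀ᶠ m : ℕ in atTop, ∀ i, (Φ ω (B i)).toReal ≤ m :=
          eventually_all.2 fun i => tendsto_natCast_atTop_atTop.eventually_ge_atTop _
        refine le_liminf_of_le (h := hev.mono fun m hm => ?_)
        rw [ENNReal.ofReal_prod_of_nonneg fun i _ => hT0 _ _]
        refine Finset.prod_le_prod' fun i _ => ?_
        rw [hT]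
        dsimp only
        rw [max_eq_left ENNReal.toReal_nonneg, min_eq_left (hm i),
          ENNReal.ofReal_toReal (hω _ (hB' i)).ne]
    _ ≤ liminf (fun m => ∫⁻ ω, ENNReal.ofReal (∏ i, T m (Φ ω (B i)).toReal) ∂P) atTop :=
        lintegral_liminf_le fun m =>
          (Finset.measurable_fun_prod _ fun i _ => hTΦ m i).ennreal_ofReal
    _ ≤ _ := liminf_le_of_le (h := fun b hb => by
        obtain ⟨m, hm⟩ := hb.exists
        exact hm.trans (hbound m))

lemma NegativelyAssociated.measureReal_void_union_le (hNA : NegativelyAssociated P Φ)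
    (hmeas : ∀ B : Set E, MeasurableSet B → Measurable fun ω => Φ ω B)
    (hlocfin : ∀ᵐ ω ∂P, ∀ B : Set E, IsBounded B → Φ ω B < ⊤)
    {B C : Set E} (hB : MeasurableSet B) (hB' : IsBounded B)
    (hC : MeasurableSet C) (hC' : IsBounded C) (hBC : Disjoint B C) :
    P.real {ω | Φ ω (B ∪ C) = 0} ≤ P.real {ω | Φ ω B = 0} * P.real {ω | Φ ω C = 0} := by
  set f : (Fin 1 → ℝ) → ℝ := fun x => (Set.Iic (0 : ℝ)).indicator (fun _ => -1) (x 0) with hf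
  have hfm : Measurable f :=
    (measurable_const.indicator measurableSet_Iic).comp (measurable_pi_apply 0)
  have hmono : Monotone f := by
    intro x y hxy
    have := hxy 0
    simp only [hf, Set.indicator, Set.mem_Iic]
    split_ifs <;> linarith
  have hbdd : ∀ x, |f x| ≤ 1 := by
    intro x
    simp only [hf, Set.indicator, Set.mem_Iic]
    split_ifs <;> simp
  have hint : ∀ A : Set E, MeasurableSet A → IsBounded A →
      ∫ ω, f (fun _ => (Φ ω A).toReal) ∂P = -P.real {ω | Φ ω A = 0} := by
    intro A hA hA'
    have hae : (fun ω => f (fun _ => (Φ ω A).toReal)) =ᵐ[P]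
        {ω | Φ ω A = 0}.indicator (fun _ => -1) := by
      filter_upwards [hlocfin] with ω hω
      have := (hω A hA').ne
      by_cases h0 : Φ ω A = 0
      · simp [hf, h0]
      · have : 0 < (Φ ω A).toReal := ENNReal.toReal_pos h0 this
        simp [hf, h0, Set.indicator, this]
    rw [integral_congr_ae hae,
      integral_indicator_const _ (measurableSet_void hmeas hA)]
    simp
  have key := hNA.integral_mul_le hmeas (B := fun _ : Fin 1 => B) (C := fun _ : Fin 1 => C)
    (fun _ => hB) (fun _ => hB') (fun _ => hC) (fun _ => hC') (fun _ _ => hBC)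
    hfm hfm hmono hmono hbdd hbdd
  rw [hint B hB hB', hint C hC hC', neg_mul_neg] at key
  refine le_of_eq_of_le ?_ key
  have hae : (fun ω => f (fun _ => (Φ ω B).toReal) * f (fun _ => (Φ ω C).toReal)) =ᵐ[P]
      {ω | Φ ω (B ∪ C) = 0}.indicator (fun _ => 1) := by
    filter_upwards [hlocfin] with ω hω
    have h1 := (hω B hB').ne
    have h2 := (hω C hC').ne
    by_cases hB0 : Φ ω B = 0
    · by_cases hC0 : Φ ω C = 0
      · simp [hf, hB0, hC0]
      · have : 0 < (Φ ω C).toReal := ENNReal.toReal_pos hC0 h2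
        simp [hf, hC0, Set.indicator, this]
    · have : 0 < (Φ ω B).toReal := ENNReal.toReal_pos hB0 h1
      simp [hf, hB0, Set.indicator, this]
  rw [integral_congr_ae hae,
    integral_indicator_const _ (measurableSet_void hmeas (hB.union hC))]
  simp

lemma NegativelyAssociated.measureReal_void_biUnion_le (hNA : NegativelyAssociated P Φ)
    (hmeas : ∀ B : Set E, MeasurableSet B → Measurable fun ω => Φ ω B)
    (hlocfin : ∀ᵐ ω ∂P, ∀ B : Set E, IsBounded B → Φ ω B < ⊤)
    {ι : Type*} (t : Finset ι) {A : ι → Set E}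
    (hA : ∀ i ∈ t, MeasurableSet (A i)) (hA' : ∀ i ∈ t, IsBounded (A i))
    (hdisj : (t : Set ι).PairwiseDisjoint A) :
    P.real {ω | Φ ω (⋃ i ∈ t, A i) = 0} ≤ ∏ i ∈ t, P.real {ω | Φ ω (A i) = 0} := by
  classical
  induction t using Finset.induction_on with
  | empty => simp
  | insert i t hi ih =>
    rw [Finset.set_biUnion_insert, Finset.prod_insert hi]
    simp only [Finset.forall_mem_insert] at hA hA'
    rw [Finset.coe_insert, Set.pairwiseDisjoint_insert_of_notMem (by simpa using hi)] at hdisj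
    refine (hNA.measureReal_void_union_le hmeas hlocfin hA.1 hA'.1
      (t.measurableSet_biUnion hA.2)
      ((isBounded_biUnion_finset t).2 hA'.2)
      (Set.disjoint_iUnion₂_right.2 hdisj.2)).trans ?_
    exact mul_le_mul_of_nonneg_left (ih hA.2 hA'.2 hdisj.1) measureReal_nonneg

theorem NegativelyAssociated.measureReal_void_le_exp
    [CountablyGenerated E] [MeasurableSingletonClass E] (hNA : NegativelyAssociated P Φ)
    (hmeas : ∀ B : Set E, MeasurableSet B → Measurable fun ω => Φ ω B)
    (hlocfin : ∀ᵐ ω ∂P, ∀ B : Set E, IsBounded B → Φ ω B < ⊤)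
    (hsimple : ∀ᵐ ω ∂P, ∀ x : E, Φ ω {x} ≤ 1)
    {B : Set E} (hB : MeasurableSet B) (hB' : IsBounded B) :
    P.real {ω | Φ ω B = 0} ≤ Real.exp (-(∫⁻ ω, Φ ω B ∂P).toReal) := by
  set t : ℕ → Finset (Set E) := fun n => (finite_countablePartition E n).toFinset with ht
  have htm : ∀ n, ∀ s ∈ t n, MeasurableSet (s ∩ B) := fun n s hs =>
    (measurableSet_countablePartition n (by simpa [ht] using hs)).inter hB
  set N : ℕ → Ω → ℝ≥0∞ := fun n ω =>
    ∑ s ∈ t n, ({0}ᶜ : Set ℝ≥0∞).indicator 1 (Φ ω (s ∩ B)) with hN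
  have hterm : ∀ n, ∀ s ∈ t n,
      Measurable fun ω => ({0}ᶜ : Set ℝ≥0∞).indicator (1 : ℝ≥0∞ → ℝ≥0∞) (Φ ω (s ∩ B)) :=
    fun n s hs => (measurable_one.indicator (measurableSet_singleton 0).compl).comp
      (hmeas _ (htm n s hs))
  have hmean : ∫⁻ ω, Φ ω B ∂P ≤ liminf (fun n => ∫⁻ ω, N n ω ∂P) atTop := by
    refine le_trans (lintegral_mono_ae ?_)
      (lintegral_liminf_le fun n => Finset.measurable_fun_sum _ (hterm n))
    filter_upwards [hlocfin, hsimple] with ω hfin hω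
    have : IsFiniteMeasure ((Φ ω).restrict B) := ⟨by simpa using hfin B hB'⟩
    have h := measure_univ_le_liminf_card_nonnull ((Φ ω).restrict B)
      fun x => (Measure.restrict_apply_le B {x}).trans (hω x)
    simpa only [Measure.restrict_apply' hB, Set.univ_inter] using h
  have hcount : ∀ n, ∫⁻ ω, N n ω ∂P =
      ENNReal.ofReal (∑ s ∈ t n, P.real {ω | Φ ω (s ∩ B) = 0}ᶜ) := by
    intro n
    rw [lintegral_finsetSum _ (hterm n), ENNReal.ofReal_sum_of_nonneg
      fun s _ => measureReal_nonneg]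
    refine Finset.sum_congr rfl fun s hs => ?_
    rw [ofReal_measureReal, ← lintegral_indicator_one
      (measurableSet_void hmeas (htm n s hs)).compl]
    rfl
  have hexp : ∀ n, P.real {ω | Φ ω B = 0} ≤
      Real.exp (-∑ s ∈ t n, P.real {ω | Φ ω (s ∩ B) = 0}ᶜ) := by
    intro n
    have hunion : ⋃ s ∈ t n, s ∩ B = B := by
      rw [← Set.iUnion₂_inter, biUnion_countablePartition_toFinset, Set.univ_inter]
    have h := hNA.measureReal_void_biUnion_le hmeas hlocfin (t n) (A := fun s => s ∩ B)
      (htm n) (fun s _ => hB'.subset Set.inter_subset_right)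
      (fun s hs s' hs' hne => (disjoint_countablePartition (by simpa [ht] using hs)
        (by simpa [ht] using hs') hne).mono Set.inter_subset_left Set.inter_subset_left)
    rw [hunion] at h
    refine h.trans ?_
    rw [← Finset.sum_neg_distrib, Real.exp_sum]
    refine Finset.prod_le_prod (fun s _ => measureReal_nonneg) fun s hs => ?_
    rw [probReal_compl_eq_one_sub (measurableSet_void hmeas (htm n s hs))]
    have := Real.add_one_le_exp (-(1 - P.real {ω | Φ ω (s ∩ B) = 0}))
    linarith
  rcases (measureReal_nonneg (μ := P) (s := {ω | Φ ω B = 0})).eq_or_lt with h0 | hpos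
  · rw [← h0]
    exact (Real.exp_pos _).le
  have hlog : ∀ n, ∫⁻ ω, N n ω ∂P ≤ ENNReal.ofReal (-Real.log (P.real {ω | Φ ω B = 0})) := by
    intro n
    rw [hcount]
    have := (Real.log_le_iff_le_exp hpos).2 (hexp n)
    exact ENNReal.ofReal_le_ofReal (by linarith)
  have hle : ∫⁻ ω, Φ ω B ∂P ≤ ENNReal.ofReal (-Real.log (P.real {ω | Φ ω B = 0})) :=
    hmean.trans (liminf_le_of_le (h := fun b hb => by
      obtain ⟨n, hn⟩ := hb.exists
      exact hn.trans (hlog n)))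
  have hlog0 : 0 ≤ -Real.log (P.real {ω | Φ ω B = 0}) :=
    neg_nonneg.2 (Real.log_nonpos measureReal_nonneg measureReal_le_one)
  have := ENNReal.toReal_le_of_le_ofReal hlog0 hle
  rw [← Real.log_le_iff_le_exp hpos]
  linarith

end NegativeAssociation

/-- A simple, negatively associated point process with Radon mean measure is weakly sub-Poisson:
its factorial moment measures on pairwise disjoint bounded Borel sets are below the product of
the mean measures, and its void probabilities are below those of the Poisson point process with
the same mean measure. -/
theorem weakly_subPoisson_of_negatively_associated
    {d : ℕ} {Ω : Type*} [MeasurableSpace Ω] (P : Measure Ω) [IsProbabilityMeasure P]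
    (Φ : Ω → Measure (EuclideanSpace ℝ (Fin d)))
    (hmeas : ∀ B : Set (EuclideanSpace ℝ (Fin d)), MeasurableSet B →
      Measurable fun ω => Φ ω B)
    (hlocfin : ∀ᵐ ω ∂P, ∀ B : Set (EuclideanSpace ℝ (Fin d)), IsBounded B → Φ ω B < ⊤)
    (hsimple : ∀ᵐ ω ∂P, ∀ x : EuclideanSpace ℝ (Fin d), Φ ω {x} ≤ 1)
    (hα : ∀ B : Set (EuclideanSpace ℝ (Fin d)), MeasurableSet B → IsBounded B →
      ∫⁻ ω, Φ ω B ∂P < ⊤)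
    (hNA : ∀ (k l : ℕ) (B : Fin k → Set (EuclideanSpace ℝ (Fin d)))
      (C : Fin l → Set (EuclideanSpace ℝ (Fin d))),
      (∀ i, MeasurableSet (B i)) → (∀ i, IsBounded (B i)) →
      (∀ j, MeasurableSet (C j)) → (∀ j, IsBounded (C j)) →
      (∀ i j, Disjoint (B i) (C j)) →
      ∀ (f : (Fin k → ℝ) → ℝ) (g : (Fin l → ℝ) → ℝ),
        Measurable f → Measurable g → Monotone f → Monotone g →
        Integrable (fun ω => f (fun i => (Φ ω (B i)).toReal)) P →
        Integrable (fun ω => g (fun j => (Φ ω (C j)).toReal)) P →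
        Integrable (fun ω =>
          f (fun i => (Φ ω (B i)).toReal) * g (fun j => (Φ ω (C j)).toReal)) P →
        ∫ ω, f (fun i => (Φ ω (B i)).toReal) * g (fun j => (Φ ω (C j)).toReal) ∂P ≤
          (∫ ω, f (fun i => (Φ ω (B i)).toReal) ∂P) *
            (∫ ω, g (fun j => (Φ ω (C j)).toReal) ∂P)) :
    (∀ (k : ℕ) (B : Fin k → Set (EuclideanSpace ℝ (Fin d))),
      (∀ i, MeasurableSet (B i)) → (∀ i, IsBounded (B i)) →
      Pairwise (Function.onFun Disjoint B) →
      ∫⁻ ω, ∏ i, Φ ω (B i) ∂P ≤ ∏ i, ∫⁻ ω, Φ ω (B i) ∂P)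
    ∧ (∀ B : Set (EuclideanSpace ℝ (Fin d)), MeasurableSet B → IsBounded B →
      (P {ω | Φ ω B = 0}).toReal ≤ Real.exp (-(∫⁻ ω, Φ ω B ∂P).toReal)) := by
  have hNA' : NegativelyAssociated P Φ := hNA
  exact ⟨fun k B hB hB' hdisj => hNA'.lintegral_prod_le hmeas hlocfin hB hB' hdisj,
    fun B hB hB' => hNA'.measureReal_void_le_exp hmeas hlocfin hsimple hB hB'⟩
end

section
/- Let μ be a measure on ℝ^d that is finite on bounded Borel sets, and let K : ℝ^d × ℝ^d → ℂ be a measurable kernel that is Hermitian (K(x,y) = conj(K(y,x)) for all x, y) and positive semi-definite (for every n, all x_1,…,x_n ∈ ℝ^d and all z ∈ ℂ^n, Σ_{i,j} conj(z_i) K(x_i,x_j) z_j is a nonnegative real number). Let B1,…,Bk be pairwise disjoint bounded Borel sets such that x ↦ K(x,x) is μ-integrable on each Bi. Then ∫_{B1×⋯×Bk} det( K(x_i,x_j) )_{1≤i,j≤k} dμ(x_1)⋯dμ(x_k) ≤ ∏_{i=1}^k ∫_{Bi} K(x,x) dμ(x); here the determinant of each Hermitian positive semi-definite matrix (K(x_i,x_j))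 is a nonnegative real number. (This says a determinantal point process with kernel K, whose k-th factorial moment measure on disjoint sets equals the left-hand side, is α-weakly sub-Poisson.) -/
open scoped ComplexOrder

namespace Matrix

variable {n 𝕜 : Type*} [Fintype n] [DecidableEq n] [RCLike 𝕜] {A : Matrix n n 𝕜}

/-- A positive semidefinite matrix with unit diagonal has determinant at most one. -/
lemma PosSemidef.re_det_le_one (hA : A.PosSemidef) (hdiag : ∀ i, A i i = 1) :
    RCLike.re A.det ≤ 1 := by
  have htrace : ∑ i, hA.isHermitian.eigenvalues i = Fintype.card n := by
    have h := hA.isHermitian.trace_eq_sum_eigenvalues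
    simp only [trace, diag_apply, hdiag, Finset.sum_const, Finset.card_univ, nsmul_eq_mul,
      mul_one] at h
    exact_mod_cast h.symm
  rw [hA.isHermitian.det_eq_prod_eigenvalues, ← RCLike.ofReal_prod, RCLike.ofReal_re]
  calc ∏ i, hA.isHermitian.eigenvalues i
      ≤ ∏ i, Real.exp (hA.isHermitian.eigenvalues i - 1) :=
        Finset.prod_le_prod (fun i _ => hA.eigenvalues_nonneg i) fun i _ => by
          linarith [Real.add_one_le_exp (hA.isHermitian.eigenvalues i - 1)]
    _ = 1 := by simp [← Real.exp_sum, htrace]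

/-- **Hadamard's inequality**: the determinant of a positive semidefinite matrix is at most the
product of its diagonal entries. -/
theorem PosSemidef.re_det_le_prod_diag (hA : A.PosSemidef) :
    RCLike.re A.det ≤ ∏ i, RCLike.re (A i i) := by
  by_cases hdet : A.det = 0
  · rw [hdet, map_zero]
    exact Finset.prod_nonneg fun i _ => (RCLike.nonneg_iff.mp hA.diag_nonneg).1
  have hpos : A.PosDef := hA.posDef_iff_det_ne_zero.mpr hdet
  have hdiag i : 0 < RCLike.re (A i i) := (RCLike.pos_iff.mp hpos.diag_pos).1
  have hre i : A i i = (RCLike.re (A i i) : 𝕜) := (hA.isHermitian.coe_re_apply_self i).symm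
  let s : n → ℝ := fun i => (√(RCLike.re (A i i)))⁻¹
  have hs i : s i * s i * RCLike.re (A i i) = 1 := by
    rw [← mul_inv, Real.mul_self_sqrt (hdiag i).le, inv_mul_cancel₀ (hdiag i).ne']
  let D : Matrix n n 𝕜 := diagonal fun i => (s i : 𝕜)
  have hD : D.det = ((∏ i, s i : ℝ) : 𝕜) := by simp [D]
  have hDstar : Dᴴ = D := by
    rw [diagonal_conjTranspose]
    congr 1
    ext i
    simp
  have hone := (hA.mul_mul_conjTranspose_same D).re_det_le_one fun i => by
    rw [hDstar, mul_diagonal, diagonal_mul, hre i, ← RCLike.ofReal_mul, ← RCLike.ofReal_mul,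
      mul_right_comm, hs, RCLike.ofReal_one]
  rw [hDstar, det_mul, det_mul, hD, mul_right_comm, ← RCLike.ofReal_mul,
    RCLike.re_ofReal_mul] at hone
  have hprod : (∏ i, s i) * (∏ i, s i) * ∏ i, RCLike.re (A i i) = 1 := by
    simp [← Finset.prod_mul_distrib, hs]
  have hspos : 0 < ∏ i, s i := Finset.prod_pos fun i _ => inv_pos.mpr (Real.sqrt_pos.mpr (hdiag i))
  rw [← hprod] at hone
  exact le_of_mul_le_mul_left hone (mul_pos hspos hspos)

end Matrix

open MeasureTheory Bornology

/-- Hadamard's inequality integrated: for a Hermitian, positive semi-definite measurable kernel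
`K` and pairwise disjoint bounded Borel sets `B₁,…,B_k` on which `x ↦ K(x,x)` is `μ`-integrable,
the integral of `det(K(xᵢ,xⱼ))` over `B₁ × ⋯ × B_k` is at most `∏ᵢ ∫_{Bᵢ} K(x,x) dμ(x)`.
(A determinantal point process with kernel `K` is α-weakly sub-Poisson.) -/
theorem determinantal_alpha_weakly_subPoisson
    {d k : ℕ} (μ : Measure (EuclideanSpace ℝ (Fin d))) [SigmaFinite μ]
    (hμ : ∀ B : Set (EuclideanSpace ℝ (Fin d)), IsBounded B → μ B < ⊤)
    (K : EuclideanSpace ℝ (Fin d) → EuclideanSpace ℝ (Fin d) → ℂ)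
    (hKmeas : Measurable fun p : EuclideanSpace ℝ (Fin d) × EuclideanSpace ℝ (Fin d) =>
      K p.1 p.2)
    (hHerm : ∀ x y, K x y = starRingEnd ℂ (K y x))
    (hPSD : ∀ (n : ℕ) (x : Fin n → EuclideanSpace ℝ (Fin d)) (z : Fin n → ℂ),
      (∑ i, ∑ j, starRingEnd ℂ (z i) * K (x i) (x j) * z j).im = 0 ∧
      0 ≤ (∑ i, ∑ j, starRingEnd ℂ (z i) * K (x i) (x j) * z j).re)
    (B : Fin k → Set (EuclideanSpace ℝ (Fin d)))
    (hBmeas : ∀ i, MeasurableSet (B i)) (hBbdd : ∀ i, IsBounded (B i))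
    (hBdisj : Pairwise (Function.onFun Disjoint B))
    (hKint : ∀ i, IntegrableOn (fun x => (K x x).re) (B i) μ) :
    ∫ x in Set.pi Set.univ B,
        (Matrix.det (Matrix.of fun i j : Fin k => K (x i) (x j))).re
        ∂(Measure.pi fun _ : Fin k => μ) ≤
      ∏ i, ∫ x in B i, (K x x).re ∂μ := by
  have hpsd (x : Fin k → EuclideanSpace ℝ (Fin d)) :
      (Matrix.of fun i j : Fin k => K (x i) (x j)).PosSemidef := by
    refine .of_dotProduct_mulVec_nonneg ?_ fun z => ?_
    · ext i j
      exact (hHerm (x i) (x j)).symm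
    · have h := hPSD k x z
      rw [Complex.nonneg_iff]
      simpa only [dotProduct, Matrix.mulVec, Matrix.of_apply, Pi.star_apply, RCLike.star_def, Finset.mul_sum,
        mul_assoc, eq_comm, and_comm] using h
  rw [Measure.restrict_pi_pi,
    ← integral_fintype_prod_eq_prod (𝕜 := ℝ) (fun _ x => (K x x).re)]
  refine integral_mono_of_nonneg (.of_forall fun x => ?_) (.fintype_prod hKint)
    (.of_forall fun x => (hpsd x).re_det_le_prod_diag)
  exact (Complex.nonneg_iff.mp (hpsd x).det_nonneg).1
end

section
/- Let μ be a measure on ℝ^d that is finite on bounded Borel sets, and let K : ℝ^d × ℝ^d → ℂ be a measurable kernel that is Hermitian (K(x,y) = conj(K(y,x)) for all x, y) and positive semi-definite (for every n, all x_1,…,x_n ∈ ℝ^d and all z ∈ ℂ^n, Σ_{i,j} conj(z_i) K(x_i,x_j) z_j is a nonnegative real number). Let B1,…,Bk be pairwise disjoint bounded Borel sets. Then, with per(A) = Σ_{σ ∈ S_k} ∏_{i=1}^k A_{i,σ(i)} denoting the permanent (a nonnegative real number for each Hermitian positive semi-definite matrix (K(x_i,x_j))), the inequality ∫_{B1×⋯×Bk}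 per( K(x_i,x_j) )_{1≤i,j≤k} dμ(x_1)⋯dμ(x_k) ≥ ∏_{i=1}^k ∫_{Bi} K(x,x) dμ(x) holds in [0, ∞]. (This says a permanental point process with kernel K, whose k-th factorial moment measure on disjoint sets equals the left-hand side, is α-weakly super-Poisson.) -/
open MeasureTheory Bornology

/-- The permanent of a square complex matrix. -/
noncomputable def Matrix.permanentC {k : ℕ} (A : Matrix (Fin k) (Fin k) ℂ) : ℂ :=
  ∑ σ : Equiv.Perm (Fin k), ∏ i, A i (σ i)

namespace Matrix

open scoped ComplexOrder

variable {n : ℕ}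

/-- A finite entrywise product of positive semidefinite matrices is positive semidefinite
(Schur product theorem). -/
theorem PosSemidef.hadamard_prod {m ι : Type*} [Finite m] (s : Finset ι) (M : ι → Matrix m m ℂ)
    (hM : ∀ i ∈ s, (M i).PosSemidef) : (of fun a b => ∏ i ∈ s, M i a b).PosSemidef := by
  classical
  induction s using Finset.induction_on with
  | empty =>
    simpa [vecMulVec] using! posSemidef_vecMulVec_self_star (fun _ : m => (1 : ℂ))
  | insert i s hi ih =>
    have h := (hM i (Finset.mem_insert_self i s)).hadamard
      (ih fun j hj => hM j (Finset.mem_insert_of_mem hj))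
    convert! h using 1
    ext a b
    simp [Finset.prod_insert hi]

/-- The sum of all entries of a positive semidefinite matrix is nonnegative. -/
theorem PosSemidef.sum_entries_nonneg {m : Type*} [Fintype m] {M : Matrix m m ℂ}
    (hM : M.PosSemidef) : 0 ≤ ∑ a, ∑ b, M a b := by
  simpa [dotProduct, mulVec] using hM.dotProduct_mulVec_nonneg (fun _ => (1 : ℂ))

/-- The polarization of the permanent is nonnegative on positive semidefinite matrices. -/
theorem sum_perm_sum_prod_update_nonneg {B C : Matrix (Fin n) (Fin n) ℂ}
    (hB : B.PosSemidef) (hC : C.PosSemidef) :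
    0 ≤ ∑ e : Equiv.Perm (Fin n), ∑ i, ∏ j, (if j = i then C else B) j (e j) := by
  have key : 0 ≤ ∑ i : Fin n, ∑ σ : Equiv.Perm (Fin n), ∑ τ : Equiv.Perm (Fin n),
      ∏ j, (if j = i then C else B) (σ j) (τ j) := by
    refine Finset.sum_nonneg fun i _ => ?_
    refine (PosSemidef.hadamard_prod Finset.univ
      (fun j => (if j = i then C else B).submatrix
        (fun σ : Equiv.Perm (Fin n) => σ j) (fun σ => σ j)) fun j _ => ?_).sum_entries_nonneg
    split_ifs
    · exact hC.submatrix _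
    · exact hB.submatrix _
  have hterm (σ : Equiv.Perm (Fin n)) :
      ∑ i : Fin n, ∑ τ : Equiv.Perm (Fin n), ∏ j, (if j = i then C else B) (σ j) (τ j) =
        ∑ e : Equiv.Perm (Fin n), ∑ i, ∏ j, (if j = i then C else B) j (e j) := by
    rw [Finset.sum_comm]
    refine (Fintype.sum_equiv (Equiv.mulRight σ) _ _ fun e => ?_).symm
    refine (Fintype.sum_equiv σ _ _ fun i => ?_).symm
    exact Fintype.prod_equiv σ _ _ fun j => by simp
  rw [Finset.sum_comm, Finset.sum_congr rfl fun σ _ => hterm σ, Finset.sum_const,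
    nsmul_eq_mul] at key
  have hcard : (0 : ℂ) < (Finset.univ : Finset (Equiv.Perm (Fin n))).card := by
    exact_mod_cast Finset.card_pos.mpr ⟨1, Finset.mem_univ _⟩
  exact le_of_mul_le_mul_left (by rwa [mul_zero]) hcard

/-- Expansion of the permanent simultaneously along the first row and the first column. -/
theorem permanentC_succ (A : Matrix (Fin (n + 1)) (Fin (n + 1)) ℂ) :
    A.permanentC = A 0 0 * (A.submatrix Fin.succ Fin.succ).permanentC +
      ∑ e : Equiv.Perm (Fin n), ∑ i, ∏ j,
        (if j = i then of fun a b : Fin n => A a.succ 0 * A 0 b.succ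
          else A.submatrix Fin.succ Fin.succ) j (e j) := by
  rw [permanentC, ← Equiv.Perm.decomposeFin.symm.sum_comp, Fintype.sum_prod_type,
    Fin.sum_univ_succ]
  congr 1
  · simp [permanentC, Finset.mul_sum, Fin.prod_univ_succ]
  · rw [Finset.sum_comm]
    refine Finset.sum_congr rfl fun e _ => (Fintype.sum_equiv e _ _ fun i => ?_).symm
    rw [Fin.prod_univ_succ, Equiv.Perm.decomposeFin_symm_apply_zero,
      ← Finset.mul_prod_erase _ _ (Finset.mem_univ i),
      ← Finset.mul_prod_erase (a := i) Finset.univ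
        (fun j : Fin n => A j.succ (Equiv.Perm.decomposeFin.symm ((e i).succ, e) j.succ))
        (Finset.mem_univ i), ← mul_assoc]
    congr 1
    · simp [mul_comm]
    · refine Finset.prod_congr rfl fun j hj => ?_
      have hji : j ≠ i := Finset.ne_of_mem_erase hj
      rw [Equiv.Perm.decomposeFin_symm_apply_succ, Equiv.swap_apply_of_ne_of_ne
        (Fin.succ_ne_zero _) (by simpa using hji)]
      simp [hji]

/-- The **Marcus inequality**, the permanental analogue of Hadamard's inequality. -/
theorem PosSemidef.prod_diag_le_permanentC {A : Matrix (Fin n) (Fin n) ℂ}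
    (hA : A.PosSemidef) : ∏ i, A i i ≤ A.permanentC := by
  induction n with
  | zero => simp [permanentC]
  | succ n ih =>
    have hB := hA.submatrix (Fin.succ : Fin n → Fin (n + 1))
    have hC : (of fun a b : Fin n => A a.succ 0 * A 0 b.succ).PosSemidef := by
      convert! posSemidef_vecMulVec_self_star (fun a : Fin n => A a.succ 0) using 1
      ext a b
      simp [vecMulVec, ← hA.isHermitian.apply 0 b.succ]
    rw [permanentC_succ, Fin.prod_univ_succ]
    calc A 0 0 * ∏ i : Fin n, A i.succ i.succ
        ≤ A 0 0 * (A.submatrix Fin.succ Fin.succ).permanentC :=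
          mul_le_mul_of_nonneg_left (ih hB) hA.diag_nonneg
      _ ≤ _ := le_add_of_nonneg_right (sum_perm_sum_prod_update_nonneg hB hC)

/-- The real parts of the diagonal entries of a matrix with nonnegative Hermitian form are
nonnegative, and their product is at most the real part of the permanent. -/
theorem prod_re_diag_le_re_permanentC {A : Matrix (Fin n) (Fin n) ℂ} (hA : A.IsHermitian)
    (hform : ∀ z : Fin n → ℂ, (∑ i, ∑ j, starRingEnd ℂ (z i) * A i j * z j).im = 0 ∧
      0 ≤ (∑ i, ∑ j, starRingEnd ℂ (z i) * A i j * z j).re) :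
    (∀ i, 0 ≤ (A i i).re) ∧ ∏ i, (A i i).re ≤ A.permanentC.re := by
  have hpsd : A.PosSemidef := by
    refine .of_dotProduct_mulVec_nonneg hA fun z => ?_
    have hz : star z ⬝ᵥ A.mulVec z = ∑ i, ∑ j, starRingEnd ℂ (z i) * A i j * z j := by
      simp [dotProduct, mulVec, Finset.mul_sum, mul_assoc]
    rw [hz, Complex.nonneg_iff]
    exact ⟨(hform z).2, (hform z).1.symm⟩
  have hdiag (i : Fin n) := Complex.nonneg_iff.mp (hpsd.diag_nonneg (i := i))
  have hre (i : Fin n) : A i i = ((A i i).re : ℂ) := Complex.ext rfl (hdiag i).2.symm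
  refine ⟨fun i => (hdiag i).1, ?_⟩
  have h := (Complex.le_def.mp hpsd.prod_diag_le_permanentC).1
  rwa [Finset.prod_congr rfl fun i _ => hre i, ← Complex.ofReal_prod, Complex.ofReal_re] at h

end Matrix

/-- Tonelli's theorem for a product of functions of separate variables. -/
theorem MeasureTheory.lintegral_pi_fin_prod_eq_prod {n : ℕ} {E : Type*} [MeasurableSpace E]
    (ν : Fin n → Measure E) [∀ i, SigmaFinite (ν i)] (f : Fin n → E → ENNReal)
    (hf : ∀ i, Measurable (f i)) :
    ∫⁻ x, ∏ i, f i (x i) ∂Measure.pi ν = ∏ i, ∫⁻ x, f i x ∂ν i := by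
  induction n with
  | zero => simp
  | succ n ih =>
    have h := (measurePreserving_piFinSuccAbove ν 0).symm
    rw [← h.lintegral_comp_emb (MeasurableEquiv.measurableEmbedding _)]
    simp only [Fin.prod_univ_succ, MeasurableEquiv.piFinSuccAbove_symm_apply, Fin.insertNthEquiv,
      Fin.zero_succAbove, Equiv.coe_fn_mk, Fin.insertNth_zero, Fin.cons_zero, Fin.cons_succ]
    rw [← ih (fun i : Fin n => ν i.succ) (fun i : Fin n => f i.succ) fun i : Fin n => hf i.succ]
    exact lintegral_prod_mul (hf 0).aemeasurable
      (Finset.measurable_prod _ fun (i : Fin n) _ =>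
        (hf i.succ).comp (measurable_pi_apply i)).aemeasurable

/-- The permanental analogue of Hadamard's inequality, integrated: for a Hermitian, positive
semi-definite measurable kernel `K` and pairwise disjoint bounded Borel sets `B₁,…,B_k`,
the integral of `per(K(xᵢ,xⱼ))` over `B₁ × ⋯ × B_k` is at least `∏ᵢ ∫_{Bᵢ} K(x,x) dμ(x)`,
the inequality holding in `[0,∞]`. (A permanental point process with kernel `K` is α-weakly
super-Poisson.) -/
theorem permanental_alpha_weakly_superPoisson
    {d k : ℕ} (μ : Measure (EuclideanSpace ℝ (Fin d))) [SigmaFinite μ]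
    (hμ : ∀ B : Set (EuclideanSpace ℝ (Fin d)), IsBounded B → μ B < ⊤)
    (K : EuclideanSpace ℝ (Fin d) → EuclideanSpace ℝ (Fin d) → ℂ)
    (hKmeas : Measurable fun p : EuclideanSpace ℝ (Fin d) × EuclideanSpace ℝ (Fin d) =>
      K p.1 p.2)
    (hHerm : ∀ x y, K x y = starRingEnd ℂ (K y x))
    (hPSD : ∀ (n : ℕ) (x : Fin n → EuclideanSpace ℝ (Fin d)) (z : Fin n → ℂ),
      (∑ i, ∑ j, starRingEnd ℂ (z i) * K (x i) (x j) * z j).im = 0 ∧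
      0 ≤ (∑ i, ∑ j, starRingEnd ℂ (z i) * K (x i) (x j) * z j).re)
    (B : Fin k → Set (EuclideanSpace ℝ (Fin d)))
    (hBmeas : ∀ i, MeasurableSet (B i)) (hBbdd : ∀ i, IsBounded (B i))
    (hBdisj : Pairwise (Function.onFun Disjoint B)) :
    ∏ i, ∫⁻ x in B i, ENNReal.ofReal (K x x).re ∂μ ≤
      ∫⁻ x in Set.pi Set.univ B,
        ENNReal.ofReal (Matrix.permanentC (Matrix.of fun i j : Fin k => K (x i) (x j))).re
        ∂(Measure.pi fun _ : Fin k => μ) := by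
  have hmeas : Measurable fun x => ENNReal.ofReal (K x x).re :=
    (Complex.measurable_re.comp
      (hKmeas.comp (measurable_id.prodMk measurable_id))).ennreal_ofReal
  rw [Measure.restrict_pi_pi, ← lintegral_pi_fin_prod_eq_prod _ _ fun _ => hmeas]
  refine lintegral_mono fun x => ?_
  obtain ⟨hdiag, hper⟩ := Matrix.prod_re_diag_le_re_permanentC
    (A := Matrix.of fun i j : Fin k => K (x i) (x j))
    (Matrix.IsHermitian.ext fun i j => (hHerm (x i) (x j)).symm) (hPSD k x)
  refine le_trans (le_of_eq ?_) (ENNReal.ofReal_le_ofReal hper)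
  exact (ENNReal.ofReal_prod_of_nonneg fun i _ => hdiag i).symm
end

section
/- Let μ be a measure on ℝ^d × ℝ^d that is finite on bounded Borel sets, and let B ⊆ ℝ^d be a bounded Borel set such that μ({(z,z) : z ∈ B}) = 0. Then for every ε > 0 there exists a finite partition of B into Borel sets B_1,…,B_m such that Σ_{j=1}^m μ(B_j × B_j) < ε; equivalently, the infimum over all finite Borel partitions {B_j} of B of Σ_j μ(B_j × B_j) is 0. -/
open MeasureTheory Bornology

/-- If `μ` is finite on `B ×ˢ B` and does not charge the diagonal over `B`, then the
`δ`-neighbourhoods of the diagonal inside `B ×ˢ B` have arbitrarily small measure. -/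
theorem exists_measure_near_diagonal_lt {X : Type*} [MetricSpace X] [MeasurableSpace X]
    [BorelSpace X] [SecondCountableTopology X] {μ : MeasureTheory.Measure (X × X)} {B : Set X}
    (hB : MeasurableSet B) (hfin : μ (B ×ˢ B) ≠ ⊤) (hdiag : μ {p : X × X | p.1 = p.2 ∧ p.1 ∈ B} = 0)
    {ε : ENNReal} (hε : 0 < ε) :
    ∃ δ : ℝ, 0 < δ ∧ μ ((B ×ˢ B) ∩ {p | dist p.1 p.2 < δ}) < ε := by
  have hmeas (δ : ℝ) : MeasurableSet ((B ×ˢ B) ∩ {p : X × X | dist p.1 p.2 < δ}) :=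
    (hB.prod hB).inter (isOpen_lt continuous_dist continuous_const).measurableSet
  have hinter : ⋂ δ : ℝ, ⋂ _ : δ > 0, (B ×ˢ B) ∩ {p : X × X | dist p.1 p.2 < δ} =
      {p : X × X | p.1 = p.2 ∧ p.1 ∈ B} := by
    ext ⟨x, y⟩
    simp only [Set.mem_iInter, Set.mem_inter_iff, Set.mem_prod, Set.mem_ofPred_eq]
    constructor
    · intro h
      exact ⟨eq_of_forall_dist_le fun δ hδ => (h δ hδ).2.le, (h 1 one_pos).1.1⟩
    · rintro ⟨rfl, hx⟩ δ hδ
      exact ⟨⟨hx, hx⟩, by simpa using hδ⟩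
  have hlim := MeasureTheory.tendsto_measure_biInter_gt (μ := μ) (a := (0 : ℝ))
    (s := fun δ : ℝ => (B ×ˢ B) ∩ {p : X × X | dist p.1 p.2 < δ})
    (fun δ _ => (hmeas δ).nullMeasurableSet)
    (fun i j _ hij p hp => ⟨hp.1, lt_of_lt_of_le hp.2 hij⟩)
    ⟨1, one_pos, MeasureTheory.measure_ne_top_of_subset Set.inter_subset_left hfin⟩
  rw [hinter, hdiag] at hlim
  obtain ⟨δ, hlt, hδ⟩ := ((hlim.eventually_lt_const hε).and self_mem_nhdsWithin).exists
  exact ⟨δ, hδ, hlt⟩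

/-- A totally bounded Borel set has a finite Borel partition into sets whose points are
pairwise at distance less than `δ`. -/
theorem TotallyBounded.exists_measurable_partition_dist_lt {X : Type*} [PseudoMetricSpace X]
    [MeasurableSpace X] [OpensMeasurableSpace X] {B : Set X} (hB : MeasurableSet B)
    (hBtb : TotallyBounded B) {δ : ℝ} (hδ : 0 < δ) :
    ∃ (m : ℕ) (P : Fin m → Set X), (∀ j, MeasurableSet (P j)) ∧
      Pairwise (Function.onFun Disjoint P) ∧ (⋃ j, P j) = B ∧
      ∀ j, ∀ x ∈ P j, ∀ y ∈ P j, dist x y < δ := by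
  obtain ⟨t, ht, hcover⟩ := Metric.totallyBounded_iff.1 hBtb (δ / 2) (half_pos hδ)
  obtain ⟨m, c, -, rfl⟩ := ht.fin_param
  let Q : Fin m → Set X := fun j => B ∩ Metric.ball (c j) (δ / 2)
  have hQ (j : Fin m) : MeasurableSet (Q j) := hB.inter Metric.isOpen_ball.measurableSet
  refine ⟨m, disjointed Q, fun j => ?_, disjoint_disjointed Q, ?_, fun j x hx y hy => ?_⟩
  · exact disjointedRec (fun _ i h => h.diff (hQ i)) (hQ j)
  · rw [iUnion_disjointed, ← Set.inter_iUnion]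
    refine Set.inter_eq_left.2 fun x hx => ?_
    simpa using hcover hx
  · have hx' := (disjointed_le Q j hx).2
    have hy' := (disjointed_le Q j hy).2
    rw [Metric.mem_ball] at hx' hy'
    linarith [dist_triangle_right x y (c j)]



/-- If a measure `μ` on `ℝ^d × ℝ^d`, finite on bounded sets, puts no mass on the diagonal
over a bounded Borel set `B`, then `B` admits finite Borel partitions `B₁,…,B_m` with
`Σ_j μ(B_j × B_j)` arbitrarily small. -/
theorem diagonal_null_partition_small
    {d : ℕ} (μ : Measure (EuclideanSpace ℝ (Fin d) × EuclideanSpace ℝ (Fin d)))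
    (hμ : ∀ A : Set (EuclideanSpace ℝ (Fin d) × EuclideanSpace ℝ (Fin d)),
      IsBounded A → μ A < ⊤)
    (B : Set (EuclideanSpace ℝ (Fin d))) (hBmeas : MeasurableSet B) (hBbdd : IsBounded B)
    (hdiag : μ {p : EuclideanSpace ℝ (Fin d) × EuclideanSpace ℝ (Fin d) |
      p.1 = p.2 ∧ p.1 ∈ B} = 0) :
    ∀ ε : ℝ, 0 < ε → ∃ (m : ℕ) (Bj : Fin m → Set (EuclideanSpace ℝ (Fin d))),
      (∀ j, MeasurableSet (Bj j)) ∧ Pairwise (Function.onFun Disjoint Bj) ∧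
      (⋃ j, Bj j) = B ∧ ∑ j, μ (Bj j ×ˢ Bj j) < ENNReal.ofReal ε := by
  intro ε hε
  obtain ⟨δ, hδ, hlt⟩ := exists_measure_near_diagonal_lt hBmeas
    (hμ _ (hBbdd.prod hBbdd)).ne hdiag (ENNReal.ofReal_pos.2 hε)
  obtain ⟨m, P, hP, hdisj, hunion, hdist⟩ :=
    (Metric.isCompact_of_isClosed_isBounded isClosed_closure
      hBbdd.closure).totallyBounded.subset subset_closure
      |>.exists_measurable_partition_dist_lt hBmeas hδ
  refine ⟨m, P, hP, hdisj, hunion, lt_of_le_of_lt ?_ hlt⟩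
  have hsub (j : Fin m) : P j ⊆ B := hunion ▸ Set.subset_iUnion P j
  rw [← tsum_fintype (L := .unconditional _), ← measure_iUnion
    (fun i j hij => Set.disjoint_prod.2 (Or.inl (hdisj hij))) fun j => (hP j).prod (hP j)]
  exact measure_mono <| Set.iUnion_subset fun j p hp =>
    ⟨⟨hsub j hp.1, hsub j hp.2⟩, hdist j _ hp.1 _ hp.2⟩
end

section
/- Let λ > 0 be a real number and let m ≤ r be positive integers with λ ≤ m. Let X ~ Bin(m, λ/m), Y ~ Bin(r, λ/r) and Z ~ Poisson(λ). Then X ≤_cx Y ≤_cx Z: for every convex function f : ℝ → ℝ such that Σ_{i≥0} |f(i)| e^{−λ} λ^i / i! < ∞, one has Σ_{i=0}^m f(i) C(m,i) (λ/m)^i (1−λ/m)^{m−i} ≤ Σ_{i=0}^r f(i) C(r,i) (λ/r)^i (1−λ/r)^{r−i} ≤ Σ_{i≥0} f(i) e^{−λ} λ^i / i!. -/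
open Finset

/-- The three-point form of convexity on the line, cleared of denominators. -/
theorem ConvexOn.three_point_le {f : ℝ → ℝ} (hf : ConvexOn ℝ Set.univ f) {x y z : ℝ}
    (hxy : x ≤ y) (hyz : y ≤ z) : (z - x) * f y ≤ (z - y) * f x + (y - x) * f z := by
  rcases hxy.eq_or_lt with rfl | hxy
  · simp
  rcases hyz.eq_or_lt with rfl | hyz
  · simp
  have h := hf.slope_mono_adjacent (Set.mem_univ x) (Set.mem_univ z) hxy hyz
  rw [div_le_div_iff₀ (sub_pos.2 hxy) (sub_pos.2 hyz)] at h
  linarith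

/-- Cut criterion for the convex order on `ℕ`: if `p` and `q` have the same mass and the same
mean, and `p` exceeds `q` exactly on a finite interval, then `p` is smaller than `q` in the convex
order. -/
theorem ConvexOn.hasSum_le_of_ordConnected {f : ℝ → ℝ} (hf : ConvexOn ℝ Set.univ f)
    {p q : ℕ → ℝ} {c μ A B : ℝ} (hp : HasSum p c) (hq : HasSum q c)
    (hpμ : HasSum (fun i : ℕ => (i : ℝ) * p i) μ) (hqμ : HasSum (fun i : ℕ => (i : ℝ) * q i) μ)
    (hconn : Set.OrdConnected {i | q i < p i}) (hfin : {i | q i < p i}.Finite)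
    (hA : HasSum (fun i : ℕ => f i * p i) A) (hB : HasSum (fun i : ℕ => f i * q i) B) :
    A ≤ B := by
  rcases Set.eq_empty_or_nonempty {i | q i < p i} with hS | hS
  · have hle : ∀ i, 0 ≤ q i - p i := fun i => by
      have : i ∉ {i | q i < p i} := by simp [hS]
      simpa using this
    have h0 : HasSum (fun i => q i - p i) 0 := by simpa using hq.sub hp
    have hpq : q = p := by
      funext i
      have := congrFun ((hasSum_zero_iff_of_nonneg hle).1 h0) i
      simpa [sub_eq_zero] using this
    subst hpq
    exact (hA.unique hB).le
  · obtain ⟨a, ha, hamin⟩ := hfin.exists_minimal hS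
    obtain ⟨b₀, hb₀, hbmax⟩ := hfin.exists_maximal hS
    have hlow : ∀ i ∈ {i | q i < p i}, a ≤ i := fun i hi => by
      by_contra! h
      exact absurd (hamin hi h.le) (by omega)
    have hupp : ∀ i ∈ {i | q i < p i}, i ≤ b₀ := fun i hi => by
      by_contra! h
      exact absurd (hbmax hi h.le) (by omega)
    obtain ⟨b, hb⟩ : ∃ b, b = max b₀ (a + 1) := ⟨_, rfl⟩
    have hab : (a : ℝ) < b := by exact_mod_cast (by omega : a < b)
    have hterm : ∀ i : ℕ,
        0 ≤ ((b - a : ℝ) * f i - (b - i) * f a - (i - a) * f b) * (q i - p i) := fun i => by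
      by_cases hi : i ∈ {i | q i < p i}
      · have h1 : (a : ℝ) ≤ i := by exact_mod_cast hlow i hi
        have h2 : (i : ℝ) ≤ b := by exact_mod_cast (by have := hupp i hi; omega : i ≤ b)
        have := hf.three_point_le h1 h2
        exact mul_nonneg_of_nonpos_of_nonpos (by linarith) (sub_nonpos.2 (le_of_lt hi))
      · refine mul_nonneg ?_ (sub_nonneg.2 (not_lt.1 hi))
        have hcases : i ≤ a ∨ b ≤ i := by
          by_contra! h
          exact hi (hconn.out ha hb₀ ⟨h.1.le, by omega⟩)
        rcases hcases with h | h
        · have := hf.three_point_le (Nat.cast_le.2 h : (i : ℝ) ≤ a) hab.le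
          linarith
        · have := hf.three_point_le hab.le (Nat.cast_le.2 h : (b : ℝ) ≤ i)
          linarith
    have hsum : HasSum (fun i : ℕ =>
        ((b - a : ℝ) * f i - (b - i) * f a - (i - a) * f b) * (q i - p i))
        ((b - a) * (B - A)) := by
      have h := ((hB.sub hA).mul_left (b - a : ℝ)).add
        (((hqμ.sub hpμ).mul_left (f a - f b)).add ((hq.sub hp).mul_left (a * f b - b * f a)))
      simp only [sub_self, mul_zero, add_zero] at h
      exact h.congr_fun fun i => by ring
    have := hsum.nonneg hterm
    exact sub_nonneg.1 (nonneg_of_mul_nonneg_right this (sub_pos.2 hab))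

/-- The recursion satisfied by the weights of `Bin(n, lam/n)` (with `s = 1/n`) and of
`Poisson(lam)` (with `s = 0`). -/
def IsBinomialLike (lam s : ℝ) (p : ℕ → ℝ) : Prop :=
  ∀ i : ℕ, (1 - lam * s) * ((i + 1) * p (i + 1)) = lam * ((1 - i * s) * p i)

namespace IsBinomialLike

variable {lam s t : ℝ} {p q : ℕ → ℝ}

theorem hasSum_mean (h : IsBinomialLike lam s p) (hp : HasSum p 1)
    (hsummable : Summable fun i : ℕ => (i : ℝ) * p i) :
    HasSum (fun i : ℕ => (i : ℝ) * p i) lam := by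
  obtain ⟨M, hM⟩ := hsummable
  have hshift : HasSum (fun i : ℕ => ((i : ℝ) + 1) * p (i + 1)) M := by
    simpa using (hasSum_nat_add_iff' 1).2 hM
  have hleft := hshift.mul_left (1 - lam * s)
  have hright : HasSum (fun i : ℕ => lam * ((1 - i * s) * p i)) (lam * (1 - s * M)) := by
    exact ((hp.sub (hM.mul_left s)).mul_left lam).congr_fun fun i => by ring
  have hM' : (1 - lam * s) * M = lam * (1 - s * M) := by
    refine hleft.unique ?_
    simpa only [h _] using hright
  have : M = lam := by linarith
  exact this ▸ hM

theorem ordConnected (hp : IsBinomialLike lam s p) (hq : IsBinomialLike lam t q)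
    (hlam : 0 < lam) (ht : 0 ≤ t) (hts : t ≤ s) (hs : lam * s ≤ 1)
    (hp0 : ∀ i, 0 ≤ p i) (hq0 : ∀ i, 0 ≤ q i) : Set.OrdConnected {i | q i < p i} := by
  rcases hs.eq_or_lt with hs | hs
  · have hmem : ∀ i ∈ {i | q i < p i}, (i : ℝ) = lam := fun i hi => by
      have hpi : p i ≠ 0 := ((hq0 i).trans_lt hi).ne'
      have h := hp i
      rw [hs, sub_self, zero_mul, eq_comm, mul_eq_zero, mul_eq_zero] at h
      have h1 : 1 - (i : ℝ) * s = 0 := by simpa [hlam.ne', hpi] using h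
      have hs0 : s ≠ 0 := by rintro rfl; simp at hs
      exact mul_right_cancel₀ hs0 (by linarith)
    refine ⟨fun i hi j hj k hk => ?_⟩
    have hij : i = j := by exact_mod_cast (hmem i hi).trans (hmem j hj).symm
    have hki : k = i := le_antisymm (hk.2.trans hij.ge) hk.1
    exact hki ▸ hi
  · have hs' : 0 < 1 - lam * s := sub_pos.2 hs
    have ht' : 0 < 1 - lam * t := by nlinarith
    have hup : ∀ i : ℕ, lam ≤ i → p i ≤ q i → p (i + 1) ≤ q (i + 1) := fun i hi hpq => by
      rcases le_or_gt (1 - (i : ℝ) * s) 0 with hn | hn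
      · have h1 : (1 - lam * s) * ((i + 1) * p (i + 1)) ≤ 0 := by
          rw [hp i]
          exact mul_nonpos_of_nonneg_of_nonpos hlam.le
            (mul_nonpos_of_nonpos_of_nonneg hn (hp0 i))
        have h2 : p (i + 1) ≤ 0 := by
          by_contra! h
          have : 0 < (1 - lam * s) * ((i + 1) * p (i + 1)) := by positivity
          linarith
        exact h2.trans (hq0 _)
      · have hratio : (1 - lam * t) * (1 - i * s) ≤ (1 - lam * s) * (1 - i * t) := by
          nlinarith [mul_nonneg (sub_nonneg.2 hts) (sub_nonneg.2 hi)]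
        have hpos : 0 < (1 - lam * t) * (1 - lam * s) * ((i : ℝ) + 1) := by positivity
        refine le_of_mul_le_mul_left ?_ hpos
        calc (1 - lam * t) * (1 - lam * s) * ((i : ℝ) + 1) * p (i + 1)
            = (1 - lam * t) * (lam * ((1 - i * s) * p i)) := by rw [← hp i]; ring
          _ = lam * ((1 - lam * t) * (1 - i * s) * p i) := by ring
          _ ≤ lam * ((1 - lam * s) * (1 - i * t) * q i) :=
              mul_le_mul_of_nonneg_left (mul_le_mul hratio hpq (hp0 i)
                ((mul_pos ht' hn).le.trans hratio)) hlam.le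
          _ = (1 - lam * s) * (lam * ((1 - i * t) * q i)) := by ring
          _ = (1 - lam * t) * (1 - lam * s) * ((i : ℝ) + 1) * q (i + 1) := by
              rw [← hq i]; ring
    have hdown : ∀ i : ℕ, (i : ℝ) ≤ lam → p (i + 1) ≤ q (i + 1) → p i ≤ q i :=
      fun i hi hpq => by
      have hn : 0 < 1 - (i : ℝ) * s := by nlinarith
      have hn' : 0 < 1 - (i : ℝ) * t := by nlinarith
      have hratio : (1 - lam * s) * (1 - i * t) ≤ (1 - lam * t) * (1 - i * s) := by
        nlinarith [mul_nonneg (sub_nonneg.2 hts) (sub_nonneg.2 hi)]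
      have hpos : 0 < lam * ((1 - (i : ℝ) * s) * (1 - i * t)) := by positivity
      refine le_of_mul_le_mul_left ?_ hpos
      calc lam * ((1 - (i : ℝ) * s) * (1 - i * t)) * p i
          = (1 - i * t) * (lam * ((1 - i * s) * p i)) := by ring
        _ = (i + 1) * ((1 - lam * s) * (1 - i * t) * p (i + 1)) := by rw [← hp i]; ring
        _ ≤ (i + 1) * ((1 - lam * t) * (1 - i * s) * q (i + 1)) :=
            mul_le_mul_of_nonneg_left (mul_le_mul hratio hpq (hp0 _)
              (mul_pos ht' hn).le) (by positivity)
        _ = (1 - i * s) * ((1 - lam * t) * ((i + 1) * q (i + 1))) := by ring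
        _ = lam * ((1 - (i : ℝ) * s) * (1 - i * t)) * q i := by rw [hq i]; ring
    refine ⟨fun i hi k hk j hj => ?_⟩
    by_contra hj'
    have hj' : p j ≤ q j := not_lt.1 hj'
    rcases le_total lam j with hlj | hlj
    · have : ∀ n, j ≤ n → p n ≤ q n := fun n hn => by
        induction n, hn using Nat.le_induction with
        | base => exact hj'
        | succ n hn ih => exact hup n (hlj.trans (Nat.cast_le.2 hn)) ih
      exact (this k hj.2).not_gt hk
    · have : p i ≤ q i := by
        refine Nat.decreasingInduction' (P := fun n => p n ≤ q n) (fun n hn _ ih => ?_) hj.1 hj'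
        exact hdown n ((Nat.cast_le.2 hn.le).trans hlj) ih
      exact this.not_gt hi

/-- Binomial-like laws of the same mean increase in the convex order as the parameter
decreases. -/
theorem hasSum_le (hp : IsBinomialLike lam s p) (hq : IsBinomialLike lam t q)
    (hlam : 0 < lam) (ht : 0 ≤ t) (hts : t ≤ s) (hs : lam * s ≤ 1)
    (hp0 : ∀ i, 0 ≤ p i) (hq0 : ∀ i, 0 ≤ q i) (hp1 : HasSum p 1) (hq1 : HasSum q 1)
    (hpfin : p.support.Finite) (hqμ : Summable fun i : ℕ => (i : ℝ) * q i)
    {f : ℝ → ℝ} (hf : ConvexOn ℝ Set.univ f) {A B : ℝ}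
    (hA : HasSum (fun i : ℕ => f i * p i) A) (hB : HasSum (fun i : ℕ => f i * q i) B) :
    A ≤ B := by
  have hpμ : Summable fun i : ℕ => (i : ℝ) * p i :=
    summable_of_hasFiniteSupport (hpfin.subset (Function.support_mul_subset_right _ _))
  exact hf.hasSum_le_of_ordConnected hp1 hq1 (hp.hasSum_mean hp1 hpμ) (hq.hasSum_mean hq1 hqμ)
    (hp.ordConnected hq hlam ht hts hs hp0 hq0)
    (hpfin.subset fun i hi => ((hq0 i).trans_lt hi).ne') hA hB

end IsBinomialLike

/-- The weights of the binomial distribution with `n` trials and mean `lam`. -/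
noncomputable def binomialWeight (lam : ℝ) (n i : ℕ) : ℝ :=
  (n.choose i : ℝ) * (lam / n) ^ i * (1 - lam / n) ^ (n - i)

/-- The weights of the Poisson distribution with mean `lam`. -/
noncomputable def poissonWeight (lam : ℝ) (i : ℕ) : ℝ :=
  Real.exp (-lam) * lam ^ i / (Nat.factorial i)

section Weights

variable {lam : ℝ} {n : ℕ}

theorem binomialWeight_eq_zero {i : ℕ} (hi : i ∉ range (n + 1)) :
    binomialWeight lam n i = 0 := by
  have : n < i := by simpa using hi
  simp [binomialWeight, Nat.choose_eq_zero_of_lt this]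

theorem binomialWeight_nonneg (hlam : 0 ≤ lam) (hn : lam ≤ n) (i : ℕ) :
    0 ≤ binomialWeight lam n i := by
  have : 0 ≤ 1 - lam / n := sub_nonneg.2 (div_le_one_of_le₀ hn n.cast_nonneg)
  unfold binomialWeight
  positivity

theorem finite_support_binomialWeight : (binomialWeight lam n).support.Finite :=
  (range (n + 1)).finite_toSet.subset fun _ hi => by
    by_contra h
    exact hi (binomialWeight_eq_zero h)

theorem hasSum_mul_binomialWeight (g : ℕ → ℝ) :
    HasSum (fun i => g i * binomialWeight lam n i)
      (∑ i ∈ range (n + 1), g i * binomialWeight lam n i) :=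
  hasSum_sum_of_ne_finset_zero fun i hi => by simp [binomialWeight_eq_zero hi]

theorem hasSum_binomialWeight : HasSum (binomialWeight lam n) 1 := by
  have h := hasSum_mul_binomialWeight (lam := lam) (n := n) fun _ => 1
  simp only [one_mul] at h
  convert h using 1
  have := add_pow (lam / n) (1 - lam / n) n
  rw [add_sub_cancel, one_pow] at this
  rw [this]
  exact sum_congr rfl fun i _ => by unfold binomialWeight; ring

theorem isBinomialLike_binomialWeight (hn : 0 < n) :
    IsBinomialLike lam (1 / n) (binomialWeight lam n) := fun i => by
  have hn0 : (n : ℝ) ≠ 0 := by positivity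
  have hch : (n.choose (i + 1) : ℝ) * (i + 1) = n.choose i * (n - i : ℕ) := by
    exact_mod_cast Nat.choose_succ_right_eq n i
  rcases lt_or_ge i n with hi | hi
  · obtain ⟨k, rfl⟩ := Nat.exists_eq_add_of_lt hi
    have h1 : i + k + 1 - i = k + 1 := by omega
    have h2 : i + k + 1 - (i + 1) = k := by omega
    have h3 : 1 - (i : ℝ) * (1 / (i + k + 1 : ℕ)) = (k + 1) / (i + k + 1 : ℕ) := by
      field_simp
      push_cast
      ring
    rw [h1] at hch
    push_cast at hch h3 hn0
    unfold binomialWeight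
    rw [h1, h2]
    push_cast
    rw [h3]
    calc _ = (1 - lam / (i + k + 1)) ^ (k + 1) * (lam / (i + k + 1)) ^ (i + 1) *
          (((i + k + 1).choose (i + 1) : ℝ) * (i + 1)) := by ring
      _ = _ := by rw [hch]; ring
  · rw [binomialWeight_eq_zero (i := i + 1) (by simp; omega)]
    rcases hi.eq_or_lt with rfl | hi
    · simp [hn0]
    · rw [binomialWeight_eq_zero (i := i) (by simp; omega)]
      simp

theorem poissonWeight_nonneg (hlam : 0 ≤ lam) (i : ℕ) : 0 ≤ poissonWeight lam i := by
  unfold poissonWeight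
  positivity

theorem hasSum_poissonWeight : HasSum (poissonWeight lam) 1 := by
  have h := (NormedSpace.expSeries_div_hasSum_exp lam).mul_left (Real.exp (-lam))
  rw [← Real.exp_eq_exp_ℝ, ← Real.exp_add, neg_add_cancel, Real.exp_zero] at h
  exact h.congr_fun fun i => mul_div_assoc _ _ _

theorem isBinomialLike_poissonWeight : IsBinomialLike lam 0 (poissonWeight lam) := fun i => by
  simp only [poissonWeight, Nat.factorial_succ]
  push_cast
  field_simp
  ring

theorem summable_mul_poissonWeight : Summable fun i : ℕ => (i : ℝ) * poissonWeight lam i := by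
  refine (summable_nat_add_iff 1).1 ?_
  refine (summable_congr fun i => ?_).2 ((hasSum_poissonWeight (lam := lam)).summable.mul_left lam)
  simpa using isBinomialLike_poissonWeight (lam := lam) i

end Weights

/-- Convex ordering `Bin(m, λ/m) ≤_cx Bin(r, λ/r) ≤_cx Poisson(λ)` for `λ ≤ m ≤ r`, stated
as inequalities between the corresponding sums against a convex function `f`. -/
theorem binomial_cx_le_binomial_cx_le_poisson
    (lam : ℝ) (hlam : 0 < lam) (m r : ℕ) (hm : 0 < m) (hmr : m ≤ r) (hlamm : lam ≤ m)
    (f : ℝ → ℝ) (hf : ConvexOn ℝ Set.univ f)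
    (hsum : Summable fun i : ℕ =>
      |f i| * (Real.exp (-lam) * lam ^ i / (Nat.factorial i))) :
    (∑ i ∈ Finset.range (m + 1),
        f i * ((m.choose i : ℝ) * (lam / m) ^ i * (1 - lam / m) ^ (m - i)) ≤
      ∑ i ∈ Finset.range (r + 1),
        f i * ((r.choose i : ℝ) * (lam / r) ^ i * (1 - lam / r) ^ (r - i)))
    ∧ (∑ i ∈ Finset.range (r + 1),
        f i * ((r.choose i : ℝ) * (lam / r) ^ i * (1 - lam / r) ^ (r - i)) ≤
      ∑' i : ℕ, f i * (Real.exp (-lam) * lam ^ i / (Nat.factorial i))) := by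
  have hr : 0 < r := hm.trans_le hmr
  have hmr' : (m : ℝ) ≤ r := Nat.cast_le.2 hmr
  have hm' : (0 : ℝ) < m := Nat.cast_pos.2 hm
  have hr' : (0 : ℝ) < r := Nat.cast_pos.2 hr
  have hlamr : lam ≤ r := hlamm.trans hmr'
  have hbin := fun n => hasSum_mul_binomialWeight (lam := lam) (n := n) fun i => f i
  constructor
  · refine (isBinomialLike_binomialWeight hm).hasSum_le (isBinomialLike_binomialWeight hr) hlam
      (by positivity) (one_div_le_one_div_of_le hm' hmr') ?_
      (binomialWeight_nonneg hlam.le hlamm) (binomialWeight_nonneg hlam.le hlamr)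
      hasSum_binomialWeight hasSum_binomialWeight finite_support_binomialWeight
      (hasSum_mul_binomialWeight _).summable hf (hbin m) (hbin r)
    rwa [mul_one_div, div_le_one hm']
  · have hsummable : Summable fun i : ℕ => f i * poissonWeight lam i := by
      refine Summable.of_norm ?_
      convert hsum using 2 with i
      rw [norm_mul, Real.norm_eq_abs, Real.norm_of_nonneg (poissonWeight_nonneg hlam.le i),
        poissonWeight]
    refine (isBinomialLike_binomialWeight hr).hasSum_le isBinomialLike_poissonWeight hlam
      le_rfl (by positivity) ?_ (binomialWeight_nonneg hlam.le hlamr)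
      (poissonWeight_nonneg hlam.le) hasSum_binomialWeight hasSum_poissonWeight
      finite_support_binomialWeight summable_mul_poissonWeight hf (hbin r) hsummable.hasSum
    rwa [mul_one_div, div_le_one hr']
end
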